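/- For a bounded continuous function g : ℝ → X and λ ∈ ℂ with Re λ < 0, the function x(ξ) = ∫_{-∞}^0 e^{-λη} g(ξ+η) dη is the unique bounded solution of ẋ(t) = λ x(t) + g(t) on ℝ. -/

import Mathlib

open Complex Set

/-- For `g ∈ BC(ℝ,X)` and `Re λ < 0`, the function
`x ξ = ∫_{-∞}^0 e^{-λη} g(ξ+η) dη` is the unique bounded solution of `ẋ = λ x + g`. -/
theorem stmt3 {X : Type*} [NormedAddCommGroup X] [NormedSpace ℂ X] [CompleteSpace X]
    (g : ℝ → X) (hgc : Continuous g) (hgb : ∃ C, ∀ t, ‖g t‖ ≤ C)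
    (lam : ℂ) (hlam : lam.re < 0)
    (x : ℝ → X) (hx : x = fun ξ => ∫ η in Iio (0:ℝ), Complex.exp (-lam * η) • g (ξ + η)) :
    ((∃ C, ∀ t, ‖x t‖ ≤ C) ∧ ∀ t, HasDerivAt x (lam • x t + g t) t) ∧
      ∀ y : ℝ → X, (∃ C, ∀ t, ‖y t‖ ≤ C) →
        (∀ t, HasDerivAt y (lam • y t + g t) t) → y = x := by
  obtain ⟨C, hC⟩ := hgb
  have hnorm : ∀ (s : ℝ), ‖Complex.exp (-lam * s)‖ = Real.exp (-lam.re * s) := by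
    intro s
    rw [Complex.norm_exp]
    simp
  have hpos : 0 < -lam.re := by linarith
  have hbd : ∀ s t : ℝ, ‖Complex.exp (-lam * s) • g t‖ ≤ C * Real.exp (-lam.re * s) := by
    intro s t
    rw [norm_smul, hnorm, mul_comm]
    exact mul_le_mul_of_nonneg_right (hC t) (Real.exp_pos _).le
  have hint : ∀ a : ℝ, MeasureTheory.IntegrableOn
      (fun s : ℝ => C * Real.exp (-lam.re * s)) (Iic a) := fun a =>
    (integrableOn_exp_mul_Iic hpos a).const_mul C
  set F : ℝ → X := fun s => Complex.exp (-lam * s) • g s with hF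
  have hFc : Continuous F := by
    rw [hF]; fun_prop
  have hFi : ∀ a, MeasureTheory.IntegrableOn F (Iic a) := fun a =>
    (hint a).mono' hFc.aestronglyMeasurable (Filter.Eventually.of_forall fun s => hbd s s)
  have hexp : ∀ (c : ℂ) (t : ℝ), HasDerivAt (fun s : ℝ => Complex.exp (c * s))
      (Complex.exp (c * t) * c) t := by
    intro c t
    have h1 : HasDerivAt (fun s : ℝ => c * (s : ℂ)) c t := by
      simpa using (Complex.ofRealCLM.hasDerivAt (x := t)).const_mul c
    exact h1.cexp
  have hxF : ∀ ξ, x ξ = Complex.exp (lam * ξ) • ((∫ s in Iic (0:ℝ), F s) + ∫ s in (0:ℝ)..ξ, F s) := by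
    intro ξ
    have h1 : (∫ s in (0:ℝ)..ξ, F s) = (∫ s in Iic ξ, F s) - ∫ s in Iic (0:ℝ), F s :=
      (intervalIntegral.integral_Iic_sub_Iic (hFi 0) (hFi ξ)).symm
    rw [h1, add_sub_cancel, hx, MeasureTheory.integral_Iic_eq_integral_Iio,
      ← MeasureTheory.integral_smul]
    have h2 := (MeasureTheory.measurePreserving_add_left MeasureTheory.volume ξ).setIntegral_preimage_emb
      (measurableEmbedding_addLeft ξ) (fun s => Complex.exp (lam * ξ) • F s) (Iio ξ)
    rw [← h2]
    have h3 : (fun x => ξ + x) ⁻¹' Iio ξ = Iio 0 := by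
      ext s; simp
    rw [h3]
    beta_reduce
    congr 1
    funext s
    simp only [hF, smul_smul, ← Complex.exp_add]
    congr 2
    push_cast
    ring
  have hxb : ∃ C, ∀ t, ‖x t‖ ≤ C := by
    refine ⟨∫ s in Iio (0:ℝ), C * Real.exp (-lam.re * s), fun t => ?_⟩
    rw [hx]
    exact MeasureTheory.norm_integral_le_of_norm_le ((hint 0).mono_set Iio_subset_Iic_self)
      (Filter.Eventually.of_forall fun s => hbd s (t + s))
  have hxd : ∀ t, HasDerivAt x (lam • x t + g t) t := by
    intro t
    have h1 : HasDerivAt (fun u => (∫ s in Iic (0:ℝ), F s) + ∫ s in (0:ℝ)..u, F s) (F t) t :=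
      (intervalIntegral.integral_hasDerivAt_right (hFc.intervalIntegrable _ _)
        (hFc.stronglyMeasurableAtFilter _ _) hFc.continuousAt).const_add _
    have h2 := (hexp lam t).smul h1
    have h3 : x = fun ξ : ℝ => Complex.exp (lam * ξ) • ((∫ s in Iic (0:ℝ), F s) + ∫ s in (0:ℝ)..ξ, F s) :=
      funext hxF
    have h4 : Complex.exp (lam * t) • F t = g t := by
      simp [hF, smul_smul, ← Complex.exp_add]
    rw [hxF t, h3]
    refine HasDerivAt.congr_deriv h2 ?_
    rw [h4, smul_smul, mul_comm lam (Complex.exp _), add_comm]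
  refine ⟨⟨hxb, hxd⟩, ?_⟩
  rintro y ⟨D, hD⟩ hy
  obtain ⟨E, hE⟩ := hxb
  have hz : ∀ t, HasDerivAt (fun t : ℝ => Complex.exp (-lam * t) • (y t - x t)) 0 t := by
    intro t
    have h := (hexp (-lam) t).smul ((hy t).sub (hxd t))
    refine HasDerivAt.congr_deriv h ?_
    simp only [Pi.sub_apply]
    module
  funext t
  have hconst : ∀ s : ℝ, Complex.exp (-lam * s) • (y s - x s) = Complex.exp (-lam * t) • (y t - x t) :=
    fun s => is_const_of_deriv_eq_zero (fun u => (hz u).differentiableAt) (fun u => (hz u).deriv) s t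
  have hle : ∀ s : ℝ, ‖Complex.exp (-lam * t) • (y t - x t)‖ ≤ Real.exp (-lam.re * s) * (D + E) := by
    intro s
    rw [← hconst s, norm_smul, hnorm]
    gcongr
    exact (norm_sub_le _ _).trans (add_le_add (hD s) (hE s))
  have hlim : Filter.Tendsto (fun s : ℝ => Real.exp (-lam.re * s) * (D + E)) Filter.atBot (nhds 0) := by
    have := (Real.tendsto_exp_atBot.comp
      (Filter.tendsto_id.const_mul_atBot hpos)).mul_const (D + E)
    simpa using this
  have h0 := ge_of_tendsto' hlim hle
  have h1 := norm_le_zero_iff.mp h0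
  rcases smul_eq_zero.mp h1 with h | h
  · exact absurd h (Complex.exp_ne_zero _)
  · exact sub_eq_zero.mp h
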